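/- Uniform support bound for the mean velocity scheme. Let V be a probability vector field satisfying (H1) with constant C > 0, let T > 0 and μ₀ ∈ 𝒫_c(ℝ^d) with supp(μ₀) ⊂ B(0,R). Then there exists K = K(R,T) > 0 (one may take K = e^{CT}(1+R) − 1) such that for every N ∈ ℕ the mean velocity scheme satisfies supp(μ̂^N_{t_j}) ⊂ B(0,K) for all j ∈ {0,…,N}. -/

import Mathlib

open MeasureTheory Set Filter Topology Metric
open scoped ENNReal NNReal Classical

noncomputable section

abbrev Euc (d : ℕ) : Type := EuclideanSpace ℝ (Fin d)

/-- The (topological) support of a measure. -/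
def msupp {X : Type*} [TopologicalSpace X] [MeasurableSpace X] (μ : Measure X) : Set X :=
  {x | ∀ U : Set X, IsOpen U → x ∈ U → 0 < μ U}

/-- Compactly supported Borel probability measures (membership in `𝒫_c`). -/
def Pc {X : Type*} [TopologicalSpace X] [MeasurableSpace X] (μ : Measure X) : Prop :=
  IsProbabilityMeasure μ ∧ ∃ K : Set X, IsCompact K ∧ μ Kᶜ = 0

/-- A probability vector field: `π₁ ♯ V[μ] = μ`. -/
def IsPVF {d : ℕ} (V : Measure (Euc d) → Measure (Euc d × Euc d)) : Prop :=
  ∀ μ : Measure (Euc d), IsProbabilityMeasure μ →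
    IsProbabilityMeasure (V μ) ∧ (V μ).map Prod.fst = μ

/-- Solution of the measure differential equation `μ̇_t = V[μ_t]` on `[0,T]`. -/
def IsMDESol {d : ℕ} (T : ℝ) (V : Measure (Euc d) → Measure (Euc d × Euc d))
    (μ : ℝ → Measure (Euc d)) : Prop :=
  ∀ f : Euc d → ℝ, ContDiff ℝ (⊤ : ℕ∞) f → HasCompactSupport f →
    IntegrableOn (fun t => ∫ p : Euc d × Euc d, fderiv ℝ f p.1 p.2 ∂(V (μ t))) (Icc 0 T) ∧
    ∀ t ∈ Icc (0 : ℝ) T,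
      (∫ x, f x ∂(μ t)) - (∫ x, f x ∂(μ 0)) =
        ∫ s in Icc (0 : ℝ) t, (∫ p : Euc d × Euc d, fderiv ℝ f p.1 p.2 ∂(V (μ s)))

/-- 1-Wasserstein distance via the Kantorovich–Rubinstein duality. -/
def W1 {X : Type*} [MeasurableSpace X] [PseudoMetricSpace X] (μ ν : Measure X) : ℝ :=
  ⨆ f : {f : X → ℝ // LipschitzWith 1 f}, ((∫ x, f.1 x ∂μ) - ∫ x, f.1 x ∂ν)

/-- Disintegration `ν_x[·]` of a measure on a product space w.r.t. the first projection. -/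
def disint {d : ℕ} (m : Measure (Euc d × Euc d)) : Euc d → Measure (Euc d) :=
  if h : IsFiniteMeasure m then
    haveI := h
    fun x => m.condKernel x
  else fun _ => 0

/-- Barycenter of the disintegration: `x ↦ ∫ v dν_x(v)`. -/
def bary {d : ℕ} (m : Measure (Euc d × Euc d)) (x : Euc d) : Euc d :=
  ∫ v, v ∂(disint m x)


section Hypotheses

/-- Condition (H1) with a given constant `C`. -/
def H1cond {d : ℕ} (C : ℝ) (V : Measure (Euc d) → Measure (Euc d × Euc d)) : Prop :=
  ∀ μ : Measure (Euc d), Pc μ →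
    ∀ p ∈ msupp (V μ), ‖p.2‖ ≤ C * (1 + ⨆ x : msupp μ, ‖(x : Euc d)‖)

/-- Hypothesis (H1): sublinearity of the PVF. -/
def H1 {d : ℕ} (V : Measure (Euc d) → Measure (Euc d × Euc d)) : Prop :=
  ∃ C > 0, H1cond C V

/-- Hypothesis (H2): continuity of the PVF `V : 𝒫_c(ℝ^d) → 𝒫_c(Tℝ^d)` w.r.t. Wasserstein. -/
def H2 {d : ℕ} (V : Measure (Euc d) → Measure (Euc d × Euc d)) : Prop :=
  (∀ μ, Pc μ → Pc (V μ)) ∧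
  ∀ μ, Pc μ → ∀ ε > 0, ∃ δ > 0, ∀ ν, Pc ν → W1 μ ν < δ → W1 (V μ) (V ν) < ε

/-- Transference plans between two measures. -/
def Couplings {X Y : Type*} [MeasurableSpace X] [MeasurableSpace Y]
    (μ : Measure X) (ν : Measure Y) : Set (Measure (X × Y)) :=
  {π | π.map Prod.fst = μ ∧ π.map Prod.snd = ν}

/-- 1-Wasserstein distance as infimum over transference plans. -/
def Wplan {X : Type*} [MeasurableSpace X] [PseudoMetricSpace X] (μ ν : Measure X) : ℝ :=
  sInf ((fun π : Measure (X × X) => ∫ p, dist p.1 p.2 ∂π) '' Couplings μ ν)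

/-- Optimal transference plans. -/
def OptCouplings {X : Type*} [MeasurableSpace X] [PseudoMetricSpace X] (μ ν : Measure X) :
    Set (Measure (X × X)) :=
  {π | π ∈ Couplings μ ν ∧ (∫ p, dist p.1 p.2 ∂π) = Wplan μ ν}

/-- The quantity `𝒲(V₁,V₂)`: minimal fiber displacement over plans whose base marginal is
an optimal plan between the two base measures. -/
def Wfib {d : ℕ} (V₁ V₂ : Measure (Euc d × Euc d)) : ℝ :=
  sInf ((fun P : Measure ((Euc d × Euc d) × (Euc d × Euc d)) => ∫ q, ‖q.1.2 - q.2.2‖ ∂P) ''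
    {P | P ∈ Couplings V₁ V₂ ∧
      P.map (fun q => (q.1.1, q.2.1)) ∈ OptCouplings (V₁.map Prod.fst) (V₂.map Prod.fst)})

/-- Hypothesis (H3): local Lipschitz continuity of the PVF in the `μ` variable. -/
def H3 {d : ℕ} (V : Measure (Euc d) → Measure (Euc d × Euc d)) : Prop :=
  ∀ R > 0, ∃ L > 0, ∀ μ ν : Measure (Euc d), Pc μ → Pc ν →
    msupp μ ⊆ ball (0 : Euc d) R → msupp ν ⊆ ball (0 : Euc d) R →
    Wfib (V μ) (V ν) ≤ L * W1 μ ν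

end Hypotheses

section Schemes

/-- The semi-discrete (in time) Lagrangian scheme at grid times `t_k = k T/N`. -/
def lagrStep {d : ℕ} (T : ℝ) (N : ℕ) (V : Measure (Euc d) → Measure (Euc d × Euc d))
    (μ₀ : Measure (Euc d)) : ℕ → Measure (Euc d)
  | 0 => μ₀
  | k + 1 => (V (lagrStep T N V μ₀ k)).map fun p => p.1 + (T / N) • p.2

/-- Time interpolation of the semi-discrete Lagrangian scheme. -/
def lagrT {d : ℕ} (T : ℝ) (N : ℕ) (V : Measure (Euc d) → Measure (Euc d × Euc d))
    (μ₀ : Measure (Euc d)) (t : ℝ) : Measure (Euc d) :=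
  if t ≤ 0 then μ₀
  else
    (V (lagrStep T N V μ₀ (⌈t / (T / N)⌉.toNat - 1))).map fun p =>
      p.1 + (t - (↑(⌈t / (T / N)⌉.toNat - 1) : ℝ) * (T / N)) • p.2

/-- The mean velocity scheme at grid times `t_j = j T/N`. -/
def mvelStep {d : ℕ} (T : ℝ) (N : ℕ) (V : Measure (Euc d) → Measure (Euc d × Euc d))
    (μ₀ : Measure (Euc d)) : ℕ → Measure (Euc d)
  | 0 => μ₀
  | j + 1 => (mvelStep T N V μ₀ j).map fun x =>
      x + (T / N) • bary (V (mvelStep T N V μ₀ j)) x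

/-- Time interpolation of the mean velocity scheme. -/
def mvelT {d : ℕ} (T : ℝ) (N : ℕ) (V : Measure (Euc d) → Measure (Euc d × Euc d))
    (μ₀ : Measure (Euc d)) (t : ℝ) : Measure (Euc d) :=
  if t ≤ 0 then μ₀
  else
    (mvelStep T N V μ₀ (⌈t / (T / N)⌉.toNat - 1)).map fun x =>
      x + (t - (↑(⌈t / (T / N)⌉.toNat - 1) : ℝ) * (T / N)) •
        bary (V (mvelStep T N V μ₀ (⌈t / (T / N)⌉.toNat - 1))) x

end Schemes

theorem msupp_eq_support {X : Type*} [TopologicalSpace X] [MeasurableSpace X] (μ : Measure X) :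
    msupp μ = μ.support := by
  ext x
  rw [Measure.mem_support_iff_forall]
  refine ⟨fun h U hU => ?_, fun h U hU hx => h U (hU.mem_nhds hx)⟩
  obtain ⟨W, hWU, hW, hxW⟩ := mem_nhds_iff.1 hU
  exact (h W hW hxW).trans_le (measure_mono hWU)

theorem msupp_subset_of_ae_mem {X : Type*} [TopologicalSpace X] [MeasurableSpace X]
    {μ : Measure X} {s : Set X} (hs : IsClosed s) (h : ∀ᵐ x ∂μ, x ∈ s) : msupp μ ⊆ s := by
  rw [msupp_eq_support]
  exact Measure.support_subset_of_isClosed hs h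

theorem ae_mem_msupp {X : Type*} [TopologicalSpace X] [HereditarilyLindelofSpace X]
    [MeasurableSpace X] (μ : Measure X) : ∀ᵐ x ∂μ, x ∈ msupp μ := by
  rw [msupp_eq_support]
  exact Measure.support_mem_ae

theorem bary_eq_integral_condKernel {d : ℕ} (m : Measure (Euc d × Euc d)) [IsFiniteMeasure m]
    (x : Euc d) : bary m x = ∫ v, v ∂(m.condKernel x) := by
  have h : IsFiniteMeasure m := inferInstance
  rw [bary, disint, dif_pos h]

theorem measurable_bary {d : ℕ} (m : Measure (Euc d × Euc d)) [IsFiniteMeasure m] :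
    Measurable (bary m) := by
  rw [funext (bary_eq_integral_condKernel m)]
  exact (stronglyMeasurable_id.integral_kernel (κ := m.condKernel)).measurable

theorem norm_bary_le_of_ae {d : ℕ} {m : Measure (Euc d × Euc d)} [IsFiniteMeasure m] {B : ℝ}
    (h : ∀ᵐ p ∂m, ‖p.2‖ ≤ B) : ∀ᵐ x ∂(m.map Prod.fst), ‖bary m x‖ ≤ B := by
  rw [← m.disintegrate m.condKernel] at h
  filter_upwards [Measure.ae_ae_of_ae_compProd h] with x hx
  rw [bary_eq_integral_condKernel]
  simpa using norm_integral_le_of_norm_le_const hx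

/-- The compactly supported probability measures concentrated on a closed ball of radius `r`
are moved by one explicit Euler step of the barycentric field to such measures on a ball of
radius `r + h * (C * (1 + r))`. -/
theorem ae_norm_le_map_bary {d : ℕ} {V : Measure (Euc d) → Measure (Euc d × Euc d)}
    (hV : IsPVF V) {C : ℝ} (hC : 0 ≤ C) (h1 : H1cond C V) {h : ℝ} (hh : 0 ≤ h)
    {μ : Measure (Euc d)} [IsProbabilityMeasure μ] {r : ℝ} (hr : 0 ≤ r)
    (hμ : ∀ᵐ x ∂μ, ‖x‖ ≤ r) :
    IsProbabilityMeasure (μ.map fun x => x + h • bary (V μ) x) ∧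
      ∀ᵐ x ∂(μ.map fun x => x + h • bary (V μ) x), ‖x‖ ≤ r + h * (C * (1 + r)) := by
  obtain ⟨hprob, hfst⟩ := hV μ inferInstance
  have hmeas : Measurable fun x => x + h • bary (V μ) x :=
    measurable_id.add ((measurable_bary (V μ)).const_smul h)
  have hPc : Pc μ := by
    refine ⟨inferInstance, closedBall 0 r, isCompact_closedBall 0 r, ?_⟩
    filter_upwards [hμ] with x hx
    simpa using hx
  have hsupp : msupp μ ⊆ closedBall 0 r :=
    msupp_subset_of_ae_mem isClosed_closedBall (by simpa using hμ)
  have hsup : ⨆ x : msupp μ, ‖(x : Euc d)‖ ≤ r :=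
    Real.iSup_le (fun x => by simpa using hsupp x.2) hr
  have hbary : ∀ᵐ x ∂μ, ‖bary (V μ) x‖ ≤ C * (1 + r) := by
    have := norm_bary_le_of_ae (m := V μ) (B := C * (1 + r)) (by
      filter_upwards [ae_mem_msupp (V μ)] with p hp
      exact (h1 μ hPc p hp).trans (by gcongr))
    rwa [hfst] at this
  refine ⟨Measure.isProbabilityMeasure_map hmeas.aemeasurable, ?_⟩
  rw [ae_map_iff hmeas.aemeasurable (measurableSet_le measurable_norm measurable_const)]
  filter_upwards [hμ, hbary] with x hx hb
  refine (norm_add_le _ _).trans ?_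
  rw [norm_smul, Real.norm_of_nonneg hh]
  gcongr

theorem ae_norm_le_mvelStep {d : ℕ} {V : Measure (Euc d) → Measure (Euc d × Euc d)}
    (hV : IsPVF V) {C : ℝ} (hC : 0 ≤ C) (h1 : H1cond C V) {T : ℝ} (hT : 0 ≤ T) (N : ℕ)
    {μ₀ : Measure (Euc d)} [IsProbabilityMeasure μ₀] {r : ℝ} (hr : 0 ≤ r)
    (hμ₀ : ∀ᵐ x ∂μ₀, ‖x‖ ≤ r) (j : ℕ) :
    IsProbabilityMeasure (mvelStep T N V μ₀ j) ∧
      ∀ᵐ x ∂(mvelStep T N V μ₀ j), ‖x‖ ≤ (1 + r) * (1 + C * (T / N)) ^ j - 1 := by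
  induction j with
  | zero => exact ⟨by simpa [mvelStep], by simpa [mvelStep] using hμ₀⟩
  | succ j ih =>
    obtain ⟨hprob, hae⟩ := ih
    have hstep : 0 ≤ T / N := by positivity
    have hpow : 1 ≤ (1 + C * (T / N)) ^ j :=
      one_le_pow₀ (le_add_of_nonneg_right (mul_nonneg hC hstep))
    obtain ⟨hprob', hae'⟩ :=
      ae_norm_le_map_bary hV hC h1 hstep (by nlinarith) hae
    refine ⟨hprob', hae'.mono fun x hx => hx.trans_eq ?_⟩
    ring

theorem one_add_mul_div_pow_le_exp {C T : ℝ} (hC : 0 ≤ C) (hT : 0 ≤ T) {N j : ℕ} (hN : 0 < N)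
    (hj : j ≤ N) : (1 + C * (T / N)) ^ j ≤ Real.exp (C * T) := by
  have hpos : 0 ≤ C * (T / N) := by positivity
  calc (1 + C * (T / N)) ^ j ≤ (1 + C * (T / N)) ^ N :=
        pow_le_pow_right₀ (le_add_of_nonneg_right hpos) hj
    _ ≤ Real.exp (C * (T / N)) ^ N := by
        gcongr
        rw [add_comm]
        exact Real.add_one_le_exp _
    _ = Real.exp (C * T) := by
        rw [← Real.exp_nat_mul]
        congr 1
        field_simp

/-- A compactly supported probability measure whose support lies in an open ball is
concentrated on a strictly smaller closed ball. -/
theorem exists_lt_ae_norm_le {d : ℕ} {μ : Measure (Euc d)} (hμ : Pc μ) {R : ℝ}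
    (hR : msupp μ ⊆ ball (0 : Euc d) R) : ∃ r, 0 ≤ r ∧ r < R ∧ ∀ᵐ x ∂μ, ‖x‖ ≤ r := by
  obtain ⟨hprob, K, hK, hK0⟩ := hμ
  have hclosed : IsClosed (msupp μ) := by
    rw [msupp_eq_support]
    exact Measure.isClosed_support
  have hcomp : IsCompact (msupp μ) :=
    hK.of_isClosed_subset hclosed (msupp_subset_of_ae_mem hK.isClosed hK0)
  have hne : (msupp μ).Nonempty := by
    rw [msupp_eq_support]
    exact Measure.nonempty_support (IsProbabilityMeasure.ne_zero μ)
  obtain ⟨y, hy, hmax⟩ := hcomp.exists_isMaxOn hne continuous_norm.continuousOn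
  exact ⟨‖y‖, norm_nonneg y, by simpa using hR hy, (ae_mem_msupp μ).mono fun x hx => hmax hx⟩

/-- uniform support bound for the mean velocity scheme, cf. `cs`: under
(H1) with constant `C`, if `supp μ₀ ⊆ B(0,R)`, there is `K = K(R,T) > 0` such that
`supp μ̂^N_{t_j} ⊆ B(0,K)` for all `N` and all `j ∈ {0,…,N}`. -/
theorem mean_velocity_support_bound {d : ℕ} (T : ℝ) (hT : 0 < T)
    (V : Measure (Euc d) → Measure (Euc d × Euc d)) (hV : IsPVF V)
    (C : ℝ) (hC : 0 < C) (h1 : H1cond C V)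
    (μ₀ : Measure (Euc d)) (hμ₀ : Pc μ₀)
    (R : ℝ) (hR : msupp μ₀ ⊆ ball (0 : Euc d) R) :
    ∃ K > 0, K ≤ Real.exp (C * T) * (1 + R) ∧
      ∀ N : ℕ, 0 < N → ∀ j : ℕ, j ≤ N →
        msupp (mvelStep T N V μ₀ j) ⊆ ball (0 : Euc d) K := by
  have := hμ₀.1
  obtain ⟨r, hr, hrR, hae⟩ := exists_lt_ae_norm_le hμ₀ hR
  have hexp : 1 ≤ Real.exp (C * T) := Real.one_le_exp (by positivity)
  refine ⟨Real.exp (C * T) * (1 + R) - 1, by nlinarith, by linarith, fun N hN j hj => ?_⟩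
  have hpow := one_add_mul_div_pow_le_exp hC.le hT.le hN hj
  refine (msupp_subset_of_ae_mem (s := closedBall 0 _) isClosed_closedBall ?_).trans
    (closedBall_subset_ball (ε₁ := (1 + r) * (1 + C * (T / N)) ^ j - 1) ?_)
  · simpa using (ae_norm_le_mvelStep hV hC.le h1 hT.le N hr hae j).2
  · nlinarith [mul_le_mul_of_nonneg_left hpow (by linarith : (0 : ℝ) ≤ 1 + r)]

end
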